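/- Let p be a prime and n ≥ 1. Let ρ be the linear map on (ZMod p)^{2n−1} defined on the standard basis f₁,…,f_{2n−1} by ρ(f_i) = f_{i+1} for 1 ≤ i ≤ 2n−2 and ρ(f_{2n−1}) = f₁ − f₂ + f₃ − ⋯ − f_{2n−2} + f_{2n−1} (the rotation of the tangle boundary by 2π/2n, using the relation f_{2n} = f₁ − f₂ + ⋯ + f_{2n−1}). Then ρ is an isometry of the tridiagonal alternating form φ_{2n−1}: φ_{2n−1}(ρx, ρy) = φ_{2n−1}(x,y) for all x, y. -/

import Mathlib

/-- The tridiagonal alternating form on `(ZMod p)^N` (standard basis `f₁, …, f_N`):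
`φ_N (f_i, f_{i+1}) = 1 = -φ_N (f_{i+1}, f_i)` and `φ_N (f_i, f_j) = 0` for `|i-j| ≠ 1`. -/
def triForm (p N : ℕ) (x y : Fin N → ZMod p) : ZMod p :=
  ∑ i : Fin N, ∑ j : Fin N,
    (if (j : ℕ) = (i : ℕ) + 1 then (1 : ZMod p)
     else if (i : ℕ) = (j : ℕ) + 1 then -1 else 0) * x i * y j

/-- The bilinear form with `B(f_i, f_{i+1}) = 1`, other values zero. -/
def upForm (p N : ℕ) : (Fin N → ZMod p) →ₗ[ZMod p] (Fin N → ZMod p) →ₗ[ZMod p] ZMod p :=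
  Matrix.toLinearMap₂' (ZMod p)
    (Matrix.of fun i j : Fin N => if (j : ℕ) = (i : ℕ) + 1 then (1 : ZMod p) else 0)

theorem upForm_apply (p N : ℕ) (x y : Fin N → ZMod p) :
    upForm p N x y = ∑ i : Fin N, ∑ j : Fin N,
      (if (j : ℕ) = (i : ℕ) + 1 then (1 : ZMod p) else 0) * x i * y j := by
  rw [upForm, Matrix.toLinearMap₂'_apply]
  refine Finset.sum_congr rfl fun i _ => Finset.sum_congr rfl fun j _ => ?_
  simp only [Matrix.of_apply, smul_eq_mul]
  ring

theorem triForm_eq (p N : ℕ) (x y : Fin N → ZMod p) :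
    triForm p N x y = (upForm p N - (upForm p N).flip) x y := by
  rw [LinearMap.sub_apply, LinearMap.sub_apply, LinearMap.flip_apply, upForm_apply,
    upForm_apply, Finset.sum_comm (f := fun i j : Fin N =>
      (if (j : ℕ) = (i : ℕ) + 1 then (1 : ZMod p) else 0) * y i * x j),
    ← Finset.sum_sub_distrib, triForm]
  refine Finset.sum_congr rfl fun i _ => ?_
  rw [← Finset.sum_sub_distrib]
  refine Finset.sum_congr rfl fun j _ => ?_
  by_cases h : (j : ℕ) = i + 1
  · have h' : ¬ ((i : ℕ) = j + 1) := by omega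
    rw [if_pos h, if_pos h, if_neg h']
    ring
  · by_cases h' : (i : ℕ) = j + 1
    · rw [if_neg h, if_pos h', if_neg h, if_pos h']
      ring
    · simp [h, h']

theorem upForm_single_left (p N : ℕ) (a : Fin N) (g : ℕ → ZMod p) :
    upForm p N (Pi.single a 1) (fun j => g j) = if (a : ℕ) + 1 < N then g (a + 1) else 0 := by
  rw [upForm_apply, Finset.sum_eq_single a]
  · split_ifs with h
    · rw [Finset.sum_eq_single ⟨a + 1, h⟩]
      · simp
      · intro b _ hb
        rw [if_neg (fun hh => hb (Fin.ext hh))]; simp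
      · simp
    · refine Finset.sum_eq_zero fun j _ => ?_
      rw [if_neg (by omega)]; simp
  · intro b _ hb
    simp [Pi.single_eq_of_ne hb]
  · simp

theorem upForm_single_right (p N : ℕ) (a : Fin N) (g : ℕ → ZMod p) :
    upForm p N (fun j => g j) (Pi.single a 1) = if 0 < (a : ℕ) then g (a - 1) else 0 := by
  rw [upForm_apply, Finset.sum_comm, Finset.sum_eq_single a]
  · split_ifs with h
    · rw [Finset.sum_eq_single ⟨a - 1, by omega⟩]
      · simp; omega
      · intro b _ hb
        rw [if_neg (fun hh => hb (Fin.ext (by simp; omega)))]; simp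
      · simp
    · refine Finset.sum_eq_zero fun j _ => ?_
      rw [if_neg (by omega)]; simp
  · intro b _ hb
    simp [Pi.single_eq_of_ne hb]
  · simp

theorem upForm_single_single (p N : ℕ) (a b : Fin N) :
    upForm p N (Pi.single a 1) (Pi.single b 1) = if (b : ℕ) = a + 1 then 1 else 0 := by
  rw [upForm_apply]
  simp [Pi.single_apply]

theorem tri_alt (p n : ℕ) (a : Fin (2*n-1)) (ha : 0 < (a : ℕ)) :
    (upForm p (2*n-1) - (upForm p (2*n-1)).flip) (Pi.single a 1)
      (fun j : Fin (2*n-1) => (-1 : ZMod p) ^ (j : ℕ)) = if (a : ℕ) = 2*n-2 then 1 else 0 := by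
  rw [LinearMap.sub_apply, LinearMap.sub_apply, LinearMap.flip_apply,
    upForm_single_left p _ a (fun j => (-1) ^ j), upForm_single_right p _ a (fun j => (-1) ^ j),
    if_pos ha]
  by_cases h : (a : ℕ) = 2*n-2
  · rw [if_neg (by omega), if_pos h, Odd.neg_one_pow ⟨n - 2, by omega⟩]
    ring
  · rw [if_pos (by omega), if_neg h]
    obtain ⟨k, hk⟩ : ∃ k, (a : ℕ) = k + 1 := ⟨a - 1, by omega⟩
    rw [hk, Nat.add_sub_cancel]
    ring

/-- For a prime `p` and `n ≥ 1`, the linear map `ρ` on `(ZMod p)^{2n-1}`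
defined on the standard basis by `ρ(f_i) = f_{i+1}` for `1 ≤ i ≤ 2n-2` and
`ρ(f_{2n-1}) = f₁ - f₂ + f₃ - ⋯ - f_{2n-2} + f_{2n-1}` (the rotation of the tangle
boundary by `2π/2n`) is an isometry of the tridiagonal alternating form `φ_{2n-1}`. -/
theorem rotation_isometry (p n : ℕ) (hp : p.Prime) (hn : 1 ≤ n)
    (ρ : (Fin (2*n-1) → ZMod p) →ₗ[ZMod p] (Fin (2*n-1) → ZMod p))
    (h1 : ∀ (i : Fin (2*n-1)) (hi : (i : ℕ) < 2*n-2),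
      ρ (Pi.single i (1 : ZMod p)) = Pi.single (⟨(i : ℕ) + 1, by omega⟩ : Fin (2*n-1)) 1)
    (h2 : ρ (Pi.single (⟨2*n-2, by omega⟩ : Fin (2*n-1)) (1 : ZMod p))
      = fun j : Fin (2*n-1) => (-1 : ZMod p) ^ (j : ℕ)) :
    ∀ x y : Fin (2*n-1) → ZMod p,
      triForm p (2*n-1) (ρ x) (ρ y) = triForm p (2*n-1) x y := by
  set F := upForm p (2*n-1) - (upForm p (2*n-1)).flip with hF
  have anti : ∀ x y, F x y = - F y x := by
    intro x y
    simp [hF]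
  have self : ∀ x, F x x = 0 := by
    intro x
    simp [hF]
  have key : F.compl₁₂ ρ ρ = F := by
    refine LinearMap.ext_basis (Pi.basisFun (ZMod p) _) (Pi.basisFun (ZMod p) _) fun a b => ?_
    rw [LinearMap.compl₁₂_apply, Pi.basisFun_apply, Pi.basisFun_apply]
    have mixed : ∀ a b : Fin (2*n-1), (a : ℕ) < 2*n-2 → ¬ (b : ℕ) < 2*n-2 →
        F (ρ (Pi.single a 1)) (ρ (Pi.single b 1)) = F (Pi.single a 1) (Pi.single b 1) := by
      intro a b ha hb
      have hN : 2*n-2 < 2*n-1 := by omega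
      have hb' : b = ⟨2*n-2, hN⟩ := Fin.ext (by simp; omega)
      subst hb'
      rw [h1 a ha, h2, hF, tri_alt p n _ (Nat.succ_pos _), LinearMap.sub_apply,
        LinearMap.sub_apply, LinearMap.flip_apply, upForm_single_single, upForm_single_single]
      have h : ¬ ((a : ℕ) = 2*n-2+1) := by omega
      simp only [h, if_false, sub_zero]
      exact if_congr eq_comm rfl rfl
    by_cases ha : (a : ℕ) < 2*n-2
    · by_cases hb : (b : ℕ) < 2*n-2
      · rw [h1 a ha, h1 b hb, hF]
        simp only [LinearMap.sub_apply, LinearMap.flip_apply, upForm_single_single,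
          Nat.add_right_cancel_iff]
      · exact mixed a b ha hb
    · by_cases hb : (b : ℕ) < 2*n-2
      · rw [anti, mixed b a hb ha, ← anti]
      · have hab : a = b := Fin.ext (by omega)
        rw [hab, self, self]
  intro x y
  rw [triForm_eq, triForm_eq, ← hF]
  exact LinearMap.congr_fun₂ key x y
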